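/- In the LIBE framework below, assume the discrete inf-sup condition holds with constant α > 0: for every q ∈ Q_h, α ‖q‖_Q ≤ sup over nonzero v ∈ X_h of d(v, q)/‖G v‖. Let N ≥ 1, t* := N Δt, A := (Δt Σ_{n=0}^{N−1} ‖G u^n‖²)^{1/2}, B := (Δt Σ_{n=0}^{N−1} ‖G u^{n+1}‖²)^{1/2}, and S := (Δt Σ_{n=0}^{N−1} F_{n+1}²)^{1/2}. Then α Δt Σ_{n=0}^{N−1} ‖p^{n+1}‖_Q ≤ (1 + C_*^{-1}) [ C₁ A B + ν √(t*) B + √(t*) S ]. -/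

import Mathlib

open scoped RealInnerProductSpace

/-- The dual norm `‖w‖_{S*} := sup over nonzero v ∈ S of ⟪w, v⟫ / ‖G v‖`. -/
noncomputable def dualNorm {X Y : Type*} [NormedAddCommGroup X] [InnerProductSpace ℝ X]
    [NormedAddCommGroup Y] [InnerProductSpace ℝ Y]
    (G : X →ₗ[ℝ] Y) (S : Set X) (w : X) : ℝ :=
  ⨆ v : {v : X // v ∈ S ∧ v ≠ 0}, ⟪w, (v : X)⟫ / ‖G (v : X)‖

/-- On a finite-dimensional subspace where `G` is injective, the quotients defining the dual norm
are bounded, so the dual norm dominates each of them. -/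
theorem inner_le_dualNorm_mul {X Y : Type*} [NormedAddCommGroup X] [InnerProductSpace ℝ X]
    [NormedAddCommGroup Y] [InnerProductSpace ℝ Y] (G : X →ₗ[ℝ] Y)
    (Xh : Submodule ℝ X) [FiniteDimensional ℝ Xh] (hGinj : ∀ v ∈ Xh, G v = 0 → v = 0)
    (w : X) {v : X} (hv : v ∈ Xh) :
    ⟪w, v⟫ ≤ dualNorm G (Xh : Set X) w * ‖G v‖ := by
  rcases eq_or_ne v 0 with rfl | hv0
  · simp
  have hker : LinearMap.ker (G.domRestrict Xh) = ⊥ :=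
    LinearMap.ker_eq_bot'.2 fun x hx => Subtype.ext (hGinj x x.2 hx)
  obtain ⟨K, -, hK⟩ := (G.domRestrict Xh).exists_antilipschitzWith hker
  have hle : ∀ x ∈ Xh, ‖x‖ ≤ K * ‖G x‖ := fun x hx => by
    simpa using hK.le_mul_dist ⟨x, hx⟩ 0
  have hpos : ∀ x ∈ Xh, x ≠ 0 → 0 < ‖G x‖ := fun x hx hx0 =>
    norm_pos_iff.2 fun h => hx0 (hGinj x hx h)
  have hbdd : BddAbove (Set.range fun x : {x : X // x ∈ (Xh : Set X) ∧ x ≠ 0} =>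
      ⟪w, (x : X)⟫ / ‖G (x : X)‖) := by
    refine ⟨‖w‖ * K, ?_⟩
    rintro _ ⟨⟨x, hx, hx0⟩, rfl⟩
    rw [div_le_iff₀ (hpos x hx hx0), mul_assoc]
    exact (real_inner_le_norm w x).trans
      (mul_le_mul_of_nonneg_left (hle x hx) (norm_nonneg w))
  rw [← div_le_iff₀ (hpos v hv hv0)]
  exact le_ciSup hbdd ⟨v, hv, hv0⟩

/-- The Cauchy–Schwarz inequality for sums weighted by a constant. -/
theorem mul_sum_mul_le_sqrt_mul_sqrt {ι : Type*} (s : Finset ι) {c : ℝ} (hc : 0 ≤ c)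
    (f g : ι → ℝ) :
    c * ∑ i ∈ s, f i * g i ≤ √(c * ∑ i ∈ s, f i ^ 2) * √(c * ∑ i ∈ s, g i ^ 2) := by
  rw [Real.sqrt_mul hc, Real.sqrt_mul hc, mul_mul_mul_comm, Real.mul_self_sqrt hc]
  exact mul_le_mul_of_nonneg_left (Real.sum_mul_le_sqrt_mul_sqrt s f g) hc

/-- If the residual functional `v ↦ d v q - ⟪w, v⟫` is bounded by `K ‖G v‖` and `d · q` vanishes on
the discretely divergence-free space, then the inf-sup condition bounds `q` by `(1 + C_*⁻¹) K`. -/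
theorem infsup_norm_le_of_residual_bound {X Y Q : Type*}
    [NormedAddCommGroup X] [InnerProductSpace ℝ X]
    [NormedAddCommGroup Y] [InnerProductSpace ℝ Y]
    [NormedAddCommGroup Q] [NormedSpace ℝ Q]
    (G : X →ₗ[ℝ] Y) (Xh : Submodule ℝ X) [FiniteDimensional ℝ Xh]
    (hGinj : ∀ v ∈ Xh, G v = 0 → v = 0) (Qh : Submodule ℝ Q) (d : X →ₗ[ℝ] Q →ₗ[ℝ] ℝ)
    {Cstar α K : ℝ} (hCstar : 0 < Cstar) (hK : 0 ≤ K) {w : X} {q : Q} (hq : q ∈ Qh)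
    (hdual : Cstar * dualNorm G (Xh : Set X) w
      ≤ dualNorm G {v : X | v ∈ Xh ∧ ∀ q ∈ Qh, d v q = 0} w)
    (hinfsup : α * ‖q‖ ≤ ⨆ v : {v : X // v ∈ Xh ∧ v ≠ 0}, d (v : X) q / ‖G (v : X)‖)
    (hres : ∀ v ∈ Xh, |d v q - ⟪w, v⟫| ≤ K * ‖G v‖) :
    α * ‖q‖ ≤ (1 + Cstar⁻¹) * K := by
  have hpos : ∀ x ∈ Xh, x ≠ 0 → 0 < ‖G x‖ := fun x hx hx0 =>
    norm_pos_iff.2 fun h => hx0 (hGinj x hx h)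
  have hV : dualNorm G {v : X | v ∈ Xh ∧ ∀ q ∈ Qh, d v q = 0} w ≤ K := by
    refine Real.iSup_le ?_ hK
    rintro ⟨v, ⟨hv, hdv⟩, hv0⟩
    rw [div_le_iff₀ (hpos v hv hv0)]
    have h := (abs_le.1 (hres v hv)).1
    rw [hdv q hq] at h
    linarith
  have hX : dualNorm G (Xh : Set X) w ≤ Cstar⁻¹ * K := by
    rw [← div_eq_inv_mul, le_div_iff₀' hCstar]
    exact hdual.trans hV
  refine hinfsup.trans (Real.iSup_le ?_ (by positivity))
  rintro ⟨v, hv, hv0⟩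
  rw [div_le_iff₀ (hpos v hv hv0)]
  have h₁ := (abs_le.1 (hres v hv)).2
  have h₂ := (inner_le_dualNorm_mul G Xh hGinj w hv).trans
    (mul_le_mul_of_nonneg_right hX (norm_nonneg (G v)))
  linarith

/-- The summed L¹-in-time pressure estimate of Corollary 4.2, before the energy bound of
Theorem 4.1 is applied:
`α Δt Σ_{n<N} ‖p^{n+1}‖ ≤ (1 + C_*⁻¹)[C₁ A B + ν √t* B + √t* S]`. -/
theorem libe_pressure_L1_presummed_bound
    {X Y Q : Type*}
    [NormedAddCommGroup X] [InnerProductSpace ℝ X]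
    [NormedAddCommGroup Y] [InnerProductSpace ℝ Y]
    [NormedAddCommGroup Q] [NormedSpace ℝ Q]
    (G : X →ₗ[ℝ] Y)
    (Xh : Submodule ℝ X) [FiniteDimensional ℝ Xh]
    (hGinj : ∀ v ∈ Xh, G v = 0 → v = 0)
    (Qh : Submodule ℝ Q)
    (d : X →ₗ[ℝ] Q →ₗ[ℝ] ℝ)
    (Cstar : ℝ) (hCstar : 0 < Cstar)
    (hdual : ∀ w ∈ {v : X | v ∈ Xh ∧ ∀ q ∈ Qh, d v q = 0},
      Cstar * dualNorm G (Xh : Set X) w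
        ≤ dualNorm G {v : X | v ∈ Xh ∧ ∀ q ∈ Qh, d v q = 0} w)
    (b : X →ₗ[ℝ] X →ₗ[ℝ] X →ₗ[ℝ] ℝ)
    (hbskew : ∀ u w : X, b u w w = 0)
    (C₁ : ℝ) (hb : ∀ u v w : X, |b u v w| ≤ C₁ * ‖G u‖ * ‖G v‖ * ‖G w‖)
    (Δt ν : ℝ) (hΔt : 0 < Δt) (hν : 0 < ν)
    (ℓ : ℕ → X →ₗ[ℝ] ℝ) (F : ℕ → ℝ)
    (hℓ : ∀ n, 1 ≤ n → ∀ v : X, |ℓ n v| ≤ F n * ‖G v‖)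
    (u : ℕ → X) (p : ℕ → Q)
    (hu : ∀ n, u n ∈ Xh) (hp : ∀ n, p n ∈ Qh)
    (hscheme : ∀ n : ℕ, ∀ v ∈ Xh,
      ⟪u (n + 1) - u n, v⟫ + Δt * b (u n) (u (n + 1)) v
        + Δt * ν * ⟪G (u (n + 1)), G v⟫ - Δt * d v (p (n + 1)) = Δt * ℓ (n + 1) v)
    (hdiv : ∀ n : ℕ, ∀ q ∈ Qh, d (u (n + 1)) q = 0)
    (hdiv0 : ∀ q ∈ Qh, d (u 0) q = 0)
    (α : ℝ) (hα : 0 < α)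
    (hinfsup : ∀ q ∈ Qh,
      α * ‖q‖ ≤ ⨆ v : {v : X // v ∈ Xh ∧ v ≠ 0}, d (v : X) q / ‖G (v : X)‖)
    (N : ℕ) (hN : 1 ≤ N)
    (tstar A B S : ℝ)
    (htstar : tstar = N * Δt)
    (hA : A = Real.sqrt (Δt * ∑ n ∈ Finset.range N, ‖G (u n)‖ ^ 2))
    (hB : B = Real.sqrt (Δt * ∑ n ∈ Finset.range N, ‖G (u (n + 1))‖ ^ 2))
    (hS : S = Real.sqrt (Δt * ∑ n ∈ Finset.range N, F (n + 1) ^ 2)) :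
    α * Δt * ∑ n ∈ Finset.range N, ‖p (n + 1)‖
      ≤ (1 + Cstar⁻¹) * (C₁ * A * B + ν * Real.sqrt tstar * B + Real.sqrt tstar * S) := by
  by_cases hX : ∃ v ∈ Xh, v ≠ 0
  · obtain ⟨v₀, hv₀, hv₀0⟩ := hX
    have hG₀ : 0 < ‖G v₀‖ := norm_pos_iff.2 fun h => hv₀0 (hGinj v₀ hv₀ h)
    have hC₁ : 0 ≤ C₁ := by
      have h := (abs_nonneg _).trans (hb v₀ v₀ v₀)
      rw [mul_assoc, mul_assoc] at h
      exact nonneg_of_mul_nonneg_left h (by positivity)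
    have hF : ∀ n, 0 ≤ F (n + 1) := fun n =>
      nonneg_of_mul_nonneg_left ((abs_nonneg _).trans (hℓ (n + 1) (by omega) v₀)) hG₀
    have hdiv' : ∀ n, ∀ q ∈ Qh, d (u n) q = 0
      | 0 => hdiv0
      | n + 1 => hdiv n
    have hstep : ∀ n, α * Δt * ‖p (n + 1)‖ ≤ (1 + Cstar⁻¹) *
        (Δt * (C₁ * (‖G (u n)‖ * ‖G (u (n + 1))‖) + ν * ‖G (u (n + 1))‖ + F (n + 1))) := by
      intro n
      have hq : Δt • p (n + 1) ∈ Qh := Qh.smul_mem _ (hp _)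
      have h := infsup_norm_le_of_residual_bound G Xh hGinj Qh d hCstar
        (K := Δt * (C₁ * (‖G (u n)‖ * ‖G (u (n + 1))‖) + ν * ‖G (u (n + 1))‖ + F (n + 1)))
        (by have := hF n; positivity) hq
        (hdual (u (n + 1) - u n) ⟨Xh.sub_mem (hu _) (hu _), fun q hq => by
          simp [hdiv' n q hq, hdiv n q hq]⟩)
        (hinfsup _ hq) ?_
      · rwa [norm_smul, Real.norm_of_nonneg hΔt.le, ← mul_assoc] at h
      intro v hv
      have hres : d v (Δt • p (n + 1)) - ⟪u (n + 1) - u n, v⟫ =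
          Δt * (b (u n) (u (n + 1)) v + ν * ⟪G (u (n + 1)), G v⟫ - ℓ (n + 1) v) := by
        rw [map_smul, smul_eq_mul]
        linarith [hscheme n v hv]
      rw [hres, abs_mul, abs_of_pos hΔt, mul_assoc]
      refine mul_le_mul_of_nonneg_left ?_ hΔt.le
      have h₁ := hb (u n) (u (n + 1)) v
      have h₂ : |ν * ⟪G (u (n + 1)), G v⟫| ≤ ν * (‖G (u (n + 1))‖ * ‖G v‖) := by
        rw [abs_mul, abs_of_pos hν]
        exact mul_le_mul_of_nonneg_left (abs_real_inner_le_norm _ _) hν.le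
      have h₃ := hℓ (n + 1) (by omega) v
      have h₄ := abs_sub (b (u n) (u (n + 1)) v + ν * ⟪G (u (n + 1)), G v⟫) (ℓ (n + 1) v)
      have h₅ := abs_add_le (b (u n) (u (n + 1)) v) (ν * ⟪G (u (n + 1)), G v⟫)
      linarith
    have hAB := mul_sum_mul_le_sqrt_mul_sqrt (Finset.range N) hΔt.le
      (fun n => ‖G (u n)‖) fun n => ‖G (u (n + 1))‖
    have htB := mul_sum_mul_le_sqrt_mul_sqrt (Finset.range N) hΔt.le
      (fun _ => 1) fun n => ‖G (u (n + 1))‖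
    have htS := mul_sum_mul_le_sqrt_mul_sqrt (Finset.range N) hΔt.le
      (fun _ => 1) fun n => F (n + 1)
    have ht : Δt * ∑ _n ∈ Finset.range N, (1 : ℝ) ^ 2 = tstar := by
      simp [htstar, mul_comm]
    simp only [ht, one_mul, ← hA, ← hB, ← hS] at hAB htB htS
    calc α * Δt * ∑ n ∈ Finset.range N, ‖p (n + 1)‖
        ≤ ∑ n ∈ Finset.range N, (1 + Cstar⁻¹) *
          (Δt * (C₁ * (‖G (u n)‖ * ‖G (u (n + 1))‖) + ν * ‖G (u (n + 1))‖ + F (n + 1))) := by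
          rw [Finset.mul_sum]
          exact Finset.sum_le_sum fun n _ => hstep n
      _ = (1 + Cstar⁻¹) * (C₁ * (Δt * ∑ n ∈ Finset.range N, ‖G (u n)‖ * ‖G (u (n + 1))‖)
          + ν * (Δt * ∑ n ∈ Finset.range N, ‖G (u (n + 1))‖)
          + Δt * ∑ n ∈ Finset.range N, F (n + 1)) := by
          simp only [← Finset.mul_sum, Finset.sum_add_distrib]
          ring
      _ ≤ (1 + Cstar⁻¹) * (C₁ * (A * B) + ν * (√tstar * B) + √tstar * S) := by
          gcongr
      _ = _ := by ring
  · push Not at hX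
    have hp0 : ∀ n, p n = 0 := fun n => by
      have : IsEmpty {v : X // v ∈ Xh ∧ v ≠ 0} := ⟨fun v => v.2.2 (hX v v.2.1)⟩
      have h := hinfsup _ (hp n)
      rw [Real.iSup_of_isEmpty] at h
      exact norm_le_zero_iff.1 (nonpos_of_mul_nonpos_right h hα)
    have hB0 : B = 0 := by simp [hB, hX _ (hu _)]
    have hS0 : 0 ≤ S := hS ▸ Real.sqrt_nonneg _
    simp only [hp0, hB0, norm_zero, Finset.sum_const_zero, mul_zero, zero_add]
    positivity
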